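/- Let α ∈ (0,1), 1 ≤ p, q ≤ ∞, and r₀, r₁ > 1. Define r_α by 1/r_α = (1−α)/r₀ + α/r₁ and let r_α* = r_α/(r_α − 1) be its Hölder conjugate. Then sup over h ∈ H^{p,q}(S) of [ Re h(iα) − (α/r₁) ‖h_1‖_{L^q(ℝ)}^{r₁} − ((1−α)/r₀) ‖h_0‖_{L^p(ℝ)}^{r₀} ] equals (1/r_α*) · ( H_{p,q}(α) )^{r_α*}. -/

import Mathlib

open MeasureTheory Complex Filter Set
open scoped Real ENNReal Topology

noncomputable section

def Strip : Set ℂ := {z : ℂ | 0 < z.im ∧ z.im < 1}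

def bLine (h : ℂ → ℂ) (y : ℝ) : ℝ → ℂ := fun x => h (x + y * Complex.I)

def hardyNorm (p q : ℝ≥0∞) (h : ℂ → ℂ) : ℝ≥0∞ :=
  ⨆ y ∈ Set.Ioo (0:ℝ) 1,
    ⨅ (f : ℝ → ℂ) (g : ℝ → ℂ) (_ : Measurable f) (_ : Measurable g)
      (_ : f + g = bLine h y),
      ENNReal.ofReal (1 - y)⁻¹ * eLpNorm f p volume +
        ENNReal.ofReal y⁻¹ * eLpNorm g q volume

def MemHardy (p q : ℝ≥0∞) (h : ℂ → ℂ) : Prop :=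
  DifferentiableOn ℂ h Strip ∧ hardyNorm p q h < ⊤

def IsTrace0 (h : ℂ → ℂ) (v : ℝ → ℂ) : Prop :=
  ∀ φ : SchwartzMap ℝ ℂ,
    Tendsto (fun y : ℝ => ∫ x : ℝ, h (x + y * Complex.I) * (starRingEnd ℂ) (φ x))
      (𝓝[>] (0:ℝ)) (𝓝 (∫ x : ℝ, v x * (starRingEnd ℂ) (φ x)))

def IsTrace1 (h : ℂ → ℂ) (w : ℝ → ℂ) : Prop :=
  ∀ φ : SchwartzMap ℝ ℂ,
    Tendsto (fun y : ℝ => ∫ x : ℝ, h (x + y * Complex.I) * (starRingEnd ℂ) (φ x))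
      (𝓝[<] (1:ℝ)) (𝓝 (∫ x : ℝ, w x * (starRingEnd ℂ) (φ x)))

def ratioSet (p q : ℝ≥0∞) (α : ℝ) : Set ℝ :=
  { r | ∃ (h : ℂ → ℂ) (h0 h1 : ℝ → ℂ), MemHardy p q h ∧ (∃ z ∈ Strip, h z ≠ 0) ∧
      IsTrace0 h h0 ∧ IsTrace1 h h1 ∧ MemLp h0 p volume ∧ MemLp h1 q volume ∧
      r = (eLpNorm (bLine h α) ⊤ volume).toReal /
        ((eLpNorm h0 p volume).toReal ^ (1 - α) * (eLpNorm h1 q volume).toReal ^ α) }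

/-- `H_{p,q}(α)`: the optimal value of the generalized three lines problem. -/
def Hval (p q : ℝ≥0∞) (α : ℝ) : ℝ := sSup (ratioSet p q α)

/-- Admissible triples. -/
structure Adm (p q : ℝ≥0∞) (h : ℂ → ℂ) (h0 h1 : ℝ → ℂ) : Prop where
  hardy : MemHardy p q h
  t0 : IsTrace0 h h0
  t1 : IsTrace1 h h1
  m0 : MemLp h0 p volume
  m1 : MemLp h1 q volume

lemma hardyNorm_lt_top_iff (p q : ℝ≥0∞) (h : ℂ → ℂ) :
    hardyNorm p q h < ⊤ ↔ ∃ C : ℝ≥0∞, C ≠ ⊤ ∧ ∀ y ∈ Set.Ioo (0:ℝ) 1, ∃ f g : ℝ → ℂ,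
      Measurable f ∧ Measurable g ∧ f + g = bLine h y ∧
      ENNReal.ofReal (1 - y)⁻¹ * eLpNorm f p volume +
        ENNReal.ofReal y⁻¹ * eLpNorm g q volume ≤ C := by
  constructor
  · intro H
    refine ⟨hardyNorm p q h + 1, by simp [H.ne], fun y hy => ?_⟩
    have h1 : (⨅ (f : ℝ → ℂ) (g : ℝ → ℂ) (_ : Measurable f) (_ : Measurable g)
      (_ : f + g = bLine h y),
      ENNReal.ofReal (1 - y)⁻¹ * eLpNorm f p volume +
        ENNReal.ofReal y⁻¹ * eLpNorm g q volume) < hardyNorm p q h + 1 := by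
      refine lt_of_le_of_lt ?_ (ENNReal.lt_add_right H.ne one_ne_zero)
      unfold hardyNorm
      exact le_iSup₂ (f := fun (y : ℝ) (_ : y ∈ Set.Ioo (0:ℝ) 1) =>
        ⨅ (f : ℝ → ℂ) (g : ℝ → ℂ) (_ : Measurable f) (_ : Measurable g)
      (_ : f + g = bLine h y),
      ENNReal.ofReal (1 - y)⁻¹ * eLpNorm f p volume +
        ENNReal.ofReal y⁻¹ * eLpNorm g q volume) y hy
    simp only [iInf_lt_iff] at h1
    obtain ⟨f, g, hf, hg, e, hlt⟩ := h1
    exact ⟨f, g, hf, hg, e, hlt.le⟩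
  · rintro ⟨C, hC, H⟩
    refine lt_of_le_of_lt ?_ hC.lt_top
    refine iSup₂_le fun y hy => ?_
    obtain ⟨f, g, hf, hg, e, hle⟩ := H y hy
    exact iInf_le_of_le f (iInf_le_of_le g (iInf_le_of_le hf (iInf_le_of_le hg
      (iInf_le_of_le e hle))))

lemma one_le_ofReal_inv {y : ℝ} (h0 : 0 < y) (h1 : y < 1) : 1 ≤ ENNReal.ofReal y⁻¹ := by
  rw [ENNReal.one_le_ofReal]
  exact (one_le_inv₀ h0).2 h1.le

lemma MemHardy.split {p q : ℝ≥0∞} {h : ℂ → ℂ} (H : MemHardy p q h) :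
    ∃ C : ℝ≥0∞, C ≠ ⊤ ∧ ∀ y ∈ Set.Ioo (0:ℝ) 1, ∃ f g : ℝ → ℂ,
      Measurable f ∧ Measurable g ∧ f + g = bLine h y ∧
      eLpNorm f p volume ≤ C ∧ eLpNorm g q volume ≤ C := by
  obtain ⟨C, hC, K⟩ := (hardyNorm_lt_top_iff p q h).1 H.2
  refine ⟨C, hC, fun y hy => ?_⟩
  obtain ⟨f, g, hf, hg, e, hle⟩ := K y hy
  refine ⟨f, g, hf, hg, e, le_trans ?_ (le_trans le_self_add hle),
    le_trans ?_ (le_trans le_add_self hle)⟩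
  · exact le_mul_of_one_le_left (zero_le) (one_le_ofReal_inv (by linarith [hy.2]) (by linarith [hy.1]))
  · exact le_mul_of_one_le_left (zero_le) (one_le_ofReal_inv hy.1 hy.2)

lemma isOpen_Strip : IsOpen Strip :=
  (isOpen_lt continuous_const Complex.continuous_im).inter
    (isOpen_lt Complex.continuous_im continuous_const)

lemma mem_Strip_line {x y : ℝ} (hy : y ∈ Set.Ioo (0:ℝ) 1) : (x + y * Complex.I : ℂ) ∈ Strip := by
  simpa [Strip] using hy

lemma MemHardy.continuous_line {p q : ℝ≥0∞} {h : ℂ → ℂ} (H : MemHardy p q h) {y : ℝ}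
    (hy : y ∈ Set.Ioo (0:ℝ) 1) : Continuous (bLine h y) := by
  have := H.1.continuousOn
  exact this.comp_continuous (f := fun x : ℝ => (x + y * Complex.I : ℂ)) (by fun_prop) (fun x => mem_Strip_line hy)

/-- integrals over short intervals -/
lemma lintegral_Ioo_le {p : ℝ≥0∞} (hp : 1 ≤ p) {f : ℝ → ℂ} (hf : Measurable f) (a δ : ℝ)
    (hδ : δ ≤ 1 / 2) :
    ∫⁻ x in Set.Ioo (a - δ) (a + δ), ‖f x‖ₑ ≤ eLpNorm f p volume := by
  rw [← eLpNorm_one_eq_lintegral_enorm]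
  refine (eLpNorm_le_eLpNorm_mul_rpow_measure_univ hp hf.aestronglyMeasurable).trans ?_
  have h1 : (volume.restrict (Set.Ioo (a - δ) (a + δ))) Set.univ ≤ 1 := by
    simp only [Measure.restrict_apply_univ, Real.volume_Ioo]
    exact ENNReal.ofReal_le_one.2 (by linarith)
  have h2 : (volume.restrict (Set.Ioo (a - δ) (a + δ))) Set.univ ^
      (1 / (1:ℝ≥0∞).toReal - 1 / p.toReal) ≤ 1 := by
    refine ENNReal.rpow_le_one h1 ?_
    simp only [ENNReal.toReal_one, div_one, sub_nonneg]
    rcases eq_or_ne p ⊤ with rfl | hpt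
    · simp
    · have : 1 ≤ p.toReal := by
        have := ENNReal.toReal_mono hpt hp
        simpa using this
      exact (div_le_one (by linarith)).2 this
  calc _ ≤ eLpNorm f p volume * 1 := by
        gcongr
        exact Measure.restrict_le_self
    _ = _ := mul_one _

/-- sub-mean value property over discs -/
lemma submean {h : ℂ → ℂ} {U : Set ℂ} (hh : DifferentiableOn ℂ h U) (z : ℂ)
    (δ : ℝ) (hδ : 0 < δ) (hsub : Metric.closedBall z δ ⊆ U) :
    ENNReal.ofReal (δ ^ 2 / 2) * ‖h z‖ₑ ≤ ∫⁻ w in Metric.ball (0:ℂ) δ, ‖h (z + w)‖ₑ := by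
  have hcont : ContinuousOn h U := hh.continuousOn
  -- circle estimate
  have hcirc : ∀ r ∈ Set.Ioo (0:ℝ) δ,
      ‖h z‖ₑ ≤ ∫⁻ θ in Set.Ioo (-π) π, ‖h (z + Complex.polarCoord.symm (r, θ))‖ₑ := by
    intro r hr
    have hsub' : Metric.closedBall z r ⊆ U :=
      (Metric.closedBall_subset_closedBall hr.2.le).trans hsub
    have hmv : Real.circleAverage h z r = h z := by
      apply DiffContOnCl.circleAverage
      rw [abs_of_pos hr.1]
      refine (DifferentiableOn.diffContOnCl ?_)
      rw [closure_ball z hr.1.ne']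
      exact hh.mono hsub'
    have hper : Function.Periodic (fun θ : ℝ => h (circleMap z r θ)) (2 * π) := by
      intro θ
      simp [periodic_circleMap z r θ]
    have e1 : ∫ θ in (0:ℝ)..2 * π, h (circleMap z r θ) =
        ∫ θ in (-π)..π, h (circleMap z r θ) := by
      have := hper.intervalIntegral_add_eq 0 (-π)
      rw [zero_add] at this
      rw [this]
      congr 1; ring
    rw [Real.circleAverage_def, e1, intervalIntegral.integral_of_le (by linarith [Real.pi_pos]),
      ← restrict_Ioo_eq_restrict_Ioc] at hmv
    rw [← hmv, enorm_smul]
    calc _ ≤ 1 * ‖∫ θ in Set.Ioo (-π) π, h (circleMap z r θ)‖ₑ := by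
          gcongr
          rw [Real.enorm_eq_ofReal (by positivity)]
          refine ENNReal.ofReal_le_one.2 (inv_le_one_of_one_le₀ ?_)
          linarith [Real.pi_gt_three]
      _ ≤ _ := by
          rw [one_mul]
          refine (enorm_integral_le_lintegral_enorm _).trans (le_of_eq ?_)
          congr 1
          ext θ
          congr 2
          simp [circleMap, Complex.polarCoord_symm_apply, Complex.exp_mul_I]
  have e2 : ∫⁻ w in Metric.ball (0:ℂ) δ, ‖h (z + w)‖ₑ =
      ∫⁻ w, (Metric.ball (0:ℂ) δ).indicator (fun w => ‖h (z + w)‖ₑ) w :=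
    (lintegral_indicator Metric.isOpen_ball.measurableSet _).symm
  rw [e2, ← Complex.lintegral_comp_polarCoord_symm]
  have hsubset : Set.Ioo (0:ℝ) δ ×ˢ Set.Ioo (-π) π ⊆ polarCoord.target := by
    rw [polarCoord_target]
    exact Set.prod_mono (fun x hx => hx.1) le_rfl
  refine le_trans ?_ (lintegral_mono_set hsubset)
  have e3 : ∫⁻ p in Set.Ioo (0:ℝ) δ ×ˢ Set.Ioo (-π) π, ENNReal.ofReal p.1 •
      (Metric.ball (0:ℂ) δ).indicator (fun w => ‖h (z + w)‖ₑ) (Complex.polarCoord.symm p) =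
      ∫⁻ p in Set.Ioo (0:ℝ) δ ×ˢ Set.Ioo (-π) π, ENNReal.ofReal p.1 *
        ‖h (z + Complex.polarCoord.symm p)‖ₑ := by
    refine setLIntegral_congr_fun (measurableSet_Ioo.prod measurableSet_Ioo) ?_
    rintro ⟨r, θ⟩ ⟨hr, hθ⟩
    have : Complex.polarCoord.symm (r, θ) ∈ Metric.ball (0:ℂ) δ := by
      rw [mem_ball_zero_iff, Complex.norm_polarCoord_symm, abs_of_pos hr.1]; exact hr.2
    simp only [Set.indicator_of_mem this, smul_eq_mul]
  rw [e3, Measure.volume_eq_prod, ← Measure.prod_restrict, lintegral_prod]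
  · calc ENNReal.ofReal (δ ^ 2 / 2) * ‖h z‖ₑ = ∫⁻ r in Set.Ioo (0:ℝ) δ, ENNReal.ofReal r * ‖h z‖ₑ := by
          rw [lintegral_mul_const _ (by fun_prop)]
          congr 1
          rw [← ofReal_integral_eq_lintegral_ofReal]
          · rw [← integral_Ioc_eq_integral_Ioo, ← intervalIntegral.integral_of_le hδ.le, integral_id]
            simp
          · exact (continuous_id.integrableOn_Icc).mono_set Set.Ioo_subset_Icc_self
          · exact (ae_restrict_mem measurableSet_Ioo).mono fun x hx => hx.1.le
      _ ≤ _ := by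
          refine setLIntegral_mono' measurableSet_Ioo fun r hr => ?_
          show _ ≤ ∫⁻ y in Set.Ioo (-π) π, ENNReal.ofReal r *
            ‖h (z + Complex.polarCoord.symm (r, y))‖ₑ
          rw [lintegral_const_mul']
          · gcongr
            exact hcirc r hr
          · simp
  · rw [Measure.prod_restrict]
    refine AEMeasurable.mul (f := fun p : ℝ × ℝ => ENNReal.ofReal p.1) (by fun_prop) ?_
    refine ContinuousOn.aemeasurable ?_ (measurableSet_Ioo.prod measurableSet_Ioo)
    refine ContinuousOn.enorm (hcont.comp (f := fun p => z + Complex.polarCoord.symm p) ?_ ?_)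
    · simp only [Complex.polarCoord_symm_apply]
      fun_prop
    · rintro ⟨r, θ⟩ ⟨hr, hθ⟩
      apply hsub
      rw [Metric.mem_closedBall, dist_eq_norm, add_sub_cancel_left, Complex.norm_polarCoord_symm,
        abs_of_pos hr.1]
      exact hr.2.le

lemma MemHardy.bounded_line {p q : ℝ≥0∞} (hp : 1 ≤ p) (hq : 1 ≤ q) {h : ℂ → ℂ}
    (H : MemHardy p q h) {α : ℝ} (hα : α ∈ Set.Ioo (0:ℝ) 1) :
    ∃ C : ℝ, ∀ x, ‖bLine h α x‖ ≤ C := by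
  obtain ⟨C, hC, K⟩ := H.split
  obtain ⟨δ, hδ, hδ1, hδ2, hδ3⟩ : ∃ δ : ℝ, 0 < δ ∧ δ < α ∧ δ < 1 - α ∧ δ ≤ 1 / 2 := by
    refine ⟨min α (1 - α) / 2, ?_, ?_, ?_, ?_⟩
    · have := hα.1; have := hα.2; have : 0 < min α (1 - α) := lt_min (by linarith) (by linarith)
      linarith
    · have := min_le_left α (1 - α); linarith [hα.1]
    · have := min_le_right α (1 - α); linarith [hα.2]
    · have := min_le_left α (1 - α); linarith [hα.2]
  have hmain : ∀ x : ℝ, ENNReal.ofReal (δ ^ 2 / 2) * ‖bLine h α x‖ₑ ≤ C + C := by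
    intro x
    have h1 := submean H.1 (x + α * Complex.I) δ hδ ?_
    · refine h1.trans ?_
      have hline : ∀ y ∈ Set.Ioo (-δ) δ,
          ∫⁻ t in Set.Ioo (-δ) δ, ‖h (x + α * Complex.I + (t + y * Complex.I))‖ₑ ≤ C + C := by
        intro y hy
        obtain ⟨f, g, hf, hg, e, hfC, hgC⟩ := K (α + y) ⟨by linarith [hy.1], by linarith [hy.2]⟩
        have e1 : ∀ t : ℝ, h (x + α * Complex.I + (t + y * Complex.I)) = f (x + t) + g (x + t) := by
          intro t
          have := congrFun e (x + t)
          simp only [Pi.add_apply, bLine] at this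
          rw [this]
          congr 1
          push_cast
          ring
        have tr : ∀ (p : ℝ≥0∞) (f : ℝ → ℂ), Measurable f →
            eLpNorm (fun t => f (x + t)) p volume = eLpNorm f p volume := fun p f hf =>
          eLpNorm_comp_measurePreserving hf.aestronglyMeasurable
            (measurePreserving_add_left volume x)
        have hf' : Measurable (fun t => f (x + t)) := hf.comp (measurable_const_add x)
        have hg' : Measurable (fun t => g (x + t)) := hg.comp (measurable_const_add x)
        have b1 := lintegral_Ioo_le hp hf' 0 δ hδ3
        have b2 := lintegral_Ioo_le hq hg' 0 δ hδ3
        rw [tr p f hf] at b1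
        rw [tr q g hg] at b2
        simp only [zero_sub, zero_add] at b1 b2
        calc _ ≤ ∫⁻ t in Set.Ioo (-δ) δ, (‖f (x + t)‖ₑ + ‖g (x + t)‖ₑ) := by
              refine lintegral_mono fun t => ?_
              rw [e1]
              exact enorm_add_le _ _
          _ = _ := lintegral_add_left hf'.enorm _
          _ ≤ C + C := add_le_add (b1.trans hfC) (b2.trans hgC)
      have hbs : Metric.ball (0:ℂ) δ ⊆
          Complex.measurableEquivRealProd ⁻¹' (Set.Ioo (-δ) δ ×ˢ Set.Ioo (-δ) δ) := by
        intro w hw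
        rw [mem_ball_zero_iff] at hw
        have a1 := abs_lt.1 ((Complex.abs_re_le_norm w).trans_lt hw)
        have a2 := abs_lt.1 ((Complex.abs_im_le_norm w).trans_lt hw)
        exact ⟨a1, a2⟩
      refine (lintegral_mono_set hbs).trans ?_
      have e2 := Complex.volume_preserving_equiv_real_prod.setLIntegral_comp_preimage_emb
        Complex.measurableEquivRealProd.measurableEmbedding
        (fun p : ℝ × ℝ => ‖h (x + α * Complex.I + (p.1 + p.2 * Complex.I))‖ₑ)
        (Set.Ioo (-δ) δ ×ˢ Set.Ioo (-δ) δ)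
      simp only [Complex.measurableEquivRealProd_apply, Complex.re_add_im] at e2
      rw [e2, Measure.volume_eq_prod, ← Measure.prod_restrict, lintegral_prod_symm]
      · calc _ ≤ ∫⁻ y in Set.Ioo (-δ) δ, (C + C) :=
              setLIntegral_mono' measurableSet_Ioo fun y hy => hline y hy
          _ = (C + C) * ENNReal.ofReal (δ - -δ) := by simp
          _ ≤ (C + C) * 1 := by
              gcongr
              exact ENNReal.ofReal_le_one.2 (by linarith)
          _ = C + C := mul_one _
      · rw [Measure.prod_restrict]
        refine ContinuousOn.aemeasurable ?_ (measurableSet_Ioo.prod measurableSet_Ioo)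
        refine ContinuousOn.enorm (H.1.continuousOn.comp
          (f := fun p : ℝ × ℝ => (x + α * Complex.I + (p.1 + p.2 * Complex.I) : ℂ)) ?_ ?_)
        · fun_prop
        · rintro ⟨r, y⟩ ⟨hr, hy⟩
          simp only [Strip, Set.mem_ofPred_eq]
          simp
          constructor <;> linarith [hy.1, hy.2]
    · intro w hw
      rw [mem_closedBall_iff_norm] at hw
      have a2 := abs_le.1 ((Complex.abs_im_le_norm _).trans hw)
      simp at a2
      simp only [Strip, Set.mem_ofPred_eq]
      constructor <;> linarith [a2.1, a2.2]
  refine ⟨((C + C) / ENNReal.ofReal (δ ^ 2 / 2)).toReal, fun x => ?_⟩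
  have hpos : ENNReal.ofReal (δ ^ 2 / 2) ≠ 0 := by
    rw [Ne, ENNReal.ofReal_eq_zero, not_le]; positivity
  have := hmain x
  rw [mul_comm, ← ENNReal.le_div_iff_mul_le (Or.inl hpos) (Or.inl ENNReal.ofReal_ne_top)] at this
  have h3 := ENNReal.toReal_mono ?_ this
  · simpa using h3
  · exact ENNReal.div_ne_top (by simp [hC]) hpos

/-- facts on the sup norm on the line -/
lemma MemHardy.line_sup {p q : ℝ≥0∞} (hp : 1 ≤ p) (hq : 1 ≤ q) {h : ℂ → ℂ}
    (H : MemHardy p q h) {α : ℝ} (hα : α ∈ Set.Ioo (0:ℝ) 1) :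
    (∀ x, ‖bLine h α x‖ ≤ (eLpNorm (bLine h α) ⊤ volume).toReal) ∧
    ∀ M : ℝ, 0 ≤ M → (∀ x, ‖bLine h α x‖ ≤ M) → (eLpNorm (bLine h α) ⊤ volume).toReal ≤ M := by
  obtain ⟨C, hC⟩ := H.bounded_line hp hq hα
  have key : ∀ M : ℝ, (∀ x, ‖bLine h α x‖ ≤ M) →
      eLpNorm (bLine h α) ⊤ volume ≤ ENNReal.ofReal M := by
    intro M hM
    have := eLpNorm_le_of_ae_bound (p := ⊤) (μ := volume) (ae_of_all _ hM)
    simpa using this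
  constructor
  · have hfin : eLpNorm (bLine h α) ⊤ volume ≠ ⊤ :=
      ne_top_of_le_ne_top ENNReal.ofReal_ne_top (key C hC)
    have hc := H.continuous_line hα
    have hae : ∀ᵐ x ∂(volume : Measure ℝ), ‖bLine h α x‖ₑ ≤ eLpNorm (bLine h α) ⊤ volume := by
      rw [eLpNorm_exponent_top]
      exact enorm_ae_le_eLpNormEssSup _ _
    have hae2 : ∀ᵐ x ∂(volume : Measure ℝ), x ∈
        {x | ‖bLine h α x‖ ≤ (eLpNorm (bLine h α) ⊤ volume).toReal} := by
      filter_upwards [hae] with x hx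
      simpa using ENNReal.toReal_mono hfin hx
    have hd : Dense {x | ‖bLine h α x‖ ≤ (eLpNorm (bLine h α) ⊤ volume).toReal} :=
      Measure.dense_of_ae hae2
    have hcl : IsClosed {x | ‖bLine h α x‖ ≤ (eLpNorm (bLine h α) ⊤ volume).toReal} :=
      isClosed_le hc.norm continuous_const
    intro x
    have := hd x
    rwa [hcl.closure_eq] at this
  · intro M h0 hM
    exact ENNReal.toReal_le_of_le_ofReal h0 (key M hM)

lemma temperate_exp (c : ℂ) (hc : c.re = 0) :
    Function.HasTemperateGrowth (fun x : ℝ => Complex.exp (c * x)) := by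
  have hd : ∀ n : ℕ, iteratedDeriv n (fun x : ℝ => Complex.exp (c * x)) =
      fun x : ℝ => c ^ n * Complex.exp (c * x) := by
    intro n
    induction n with
    | zero => simp
    | succ n ih =>
      rw [iteratedDeriv_succ, ih]
      ext x
      have h1 : HasDerivAt (fun x : ℝ => c * (x : ℂ)) (c * 1) x :=
        (Complex.ofRealCLM.hasDerivAt (x := x)).const_mul c
      have h2 := (h1.cexp).const_mul (c ^ n)
      rw [h2.deriv]
      ring
  have hcd : ContDiff ℝ (⊤ : ℕ∞) (fun x : ℝ => (x : ℂ)) := Complex.ofRealCLM.contDiff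
  refine ⟨by fun_prop, fun n => ⟨0, ‖c‖ ^ n, fun x => ?_⟩⟩
  rw [norm_iteratedFDeriv_eq_norm_iteratedDeriv, hd]
  simp [Complex.norm_exp, hc]

def modT (c : ℂ) (l a : ℝ) (f : ℝ → ℂ) : ℝ → ℂ :=
  fun x => c * Complex.exp (Complex.I * l * x) * f (x + a)

lemma modT_meas {c : ℂ} {l a : ℝ} {f : ℝ → ℂ} (hf : Measurable f) : Measurable (modT c l a f) := by
  unfold modT
  have : Measurable (fun x => f (x + a)) := hf.comp (measurable_add_const a)
  fun_prop

lemma modT_aesm {c : ℂ} {l a : ℝ} {f : ℝ → ℂ} (hf : AEStronglyMeasurable f volume) :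
    AEStronglyMeasurable (modT c l a f) volume := by
  unfold modT
  have : AEStronglyMeasurable (fun x => f (x + a)) volume :=
    hf.comp_measurePreserving (measurePreserving_add_right volume a)
  refine AEStronglyMeasurable.mul ?_ this
  exact Continuous.aestronglyMeasurable (by fun_prop)

lemma modT_norm (c : ℂ) (l a : ℝ) {f : ℝ → ℂ} (hf : AEStronglyMeasurable f volume) (p : ℝ≥0∞) :
    eLpNorm (modT c l a f) p volume = ‖c‖ₑ * eLpNorm f p volume := by
  have h1 : eLpNorm (fun x => f (x + a)) p volume = eLpNorm f p volume :=
    eLpNorm_comp_measurePreserving hf (measurePreserving_add_right volume a)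
  rw [← h1, ← eLpNorm_const_smul]
  refine eLpNorm_congr_norm_ae (ae_of_all _ fun x => ?_)
  simp [modT, Complex.norm_exp]

def modH (c : ℂ) (l a : ℝ) (h : ℂ → ℂ) : ℂ → ℂ :=
  fun z => c * Complex.exp (Complex.I * l * z) * h (z + a)

lemma modH_line (c : ℂ) (l a : ℝ) (h : ℂ → ℂ) (y : ℝ) :
    bLine (modH c l a h) y = modT (c * Complex.exp (-(l * y : ℝ))) l a (bLine h y) := by
  ext x
  simp only [bLine, modH, modT]
  have e1 : Complex.exp (Complex.I * l * (x + y * Complex.I)) =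
      Complex.exp (-(l * y : ℝ)) * Complex.exp (Complex.I * l * x) := by
    rw [← Complex.exp_add]
    congr 1
    push_cast
    linear_combination (l * y : ℂ) * Complex.I_mul_I
  have e2 : ((x : ℂ) + y * Complex.I + a) = ((x + a : ℝ) : ℂ) + y * Complex.I := by
    push_cast; ring
  rw [e1, e2]
  ring

lemma modH_trace (c : ℂ) (l a : ℝ) (h : ℂ → ℂ) (v : ℝ → ℂ) (F : Filter ℝ) (y₀ : ℝ)
    (hF : F ≤ 𝓝 y₀)
    (H : ∀ φ : SchwartzMap ℝ ℂ,
      Tendsto (fun y : ℝ => ∫ x : ℝ, h (x + y * Complex.I) * (starRingEnd ℂ) (φ x))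
      F (𝓝 (∫ x : ℝ, v x * (starRingEnd ℂ) (φ x)))) (φ : SchwartzMap ℝ ℂ) :
    Tendsto (fun y : ℝ => ∫ x : ℝ, modH c l a h (x + y * Complex.I) * (starRingEnd ℂ) (φ x))
      F (𝓝 (∫ x : ℝ, modT (c * Complex.exp (-(l * y₀ : ℝ))) l a v x * (starRingEnd ℂ) (φ x))) := by
  have htg := temperate_exp (-(Complex.I * l)) (by simp)
  obtain ⟨ψ, hψ⟩ : ∃ ψ : SchwartzMap ℝ ℂ, ∀ x, ψ x =
      Complex.exp (-(Complex.I * l) * ((x - a : ℝ) : ℂ)) * φ (x - a) := by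
    refine ⟨(SchwartzMap.smulLeftCLM ℂ (fun x : ℝ => Complex.exp (-(Complex.I * l) * x)) φ).compSubConstCLM ℂ a, fun x => ?_⟩
    rw [SchwartzMap.compSubConstCLM_apply, SchwartzMap.smulLeftCLM_apply_apply htg, smul_eq_mul]
  have key : ∀ (d : ℂ) (u : ℝ → ℂ), ∫ x : ℝ, modT d l a u x * (starRingEnd ℂ) (φ x) =
      d * ∫ x : ℝ, u x * (starRingEnd ℂ) (ψ x) := by
    intro d u
    rw [← integral_const_mul, 
      ← integral_add_right_eq_self (fun x => d * (u x * (starRingEnd ℂ) (ψ x))) a]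
    congr 1
    ext x
    rw [hψ]
    simp only [modT, map_mul, ← Complex.exp_conj, map_neg, Complex.conj_I, Complex.conj_ofReal,
      add_sub_cancel_right, neg_mul, neg_neg]
    ring
  rw [key]
  have e : (fun y : ℝ => ∫ x : ℝ, modH c l a h (x + y * Complex.I) * (starRingEnd ℂ) (φ x)) =
      fun y : ℝ => (c * Complex.exp (-(l * y : ℝ))) *
        ∫ x : ℝ, h (x + y * Complex.I) * (starRingEnd ℂ) (ψ x) := by
    ext y
    rw [← key _ (fun x => h (x + y * Complex.I))]
    have := modH_line c l a h y
    congr 1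
    ext x
    exact congrArg (· * _) (congrFun this x)
  rw [e]
  refine Tendsto.mul ?_ (H ψ)
  have : Continuous (fun y : ℝ => c * Complex.exp (-(l * y : ℝ))) := by fun_prop
  exact (this.tendsto y₀).mono_left hF

lemma modH_hardy {p q : ℝ≥0∞} (c : ℂ) (l a : ℝ) {h : ℂ → ℂ} (H : MemHardy p q h) :
    MemHardy p q (modH c l a h) := by
  refine ⟨?_, ?_⟩
  · unfold modH
    refine DifferentiableOn.mul (by fun_prop) ?_
    refine H.1.comp (f := fun z : ℂ => z + a) (by fun_prop) ?_
    intro z hz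
    simpa [Strip] using hz
  · rw [hardyNorm_lt_top_iff]
    obtain ⟨C, hC, K⟩ := (hardyNorm_lt_top_iff p q h).1 H.2
    refine ⟨ENNReal.ofReal (‖c‖ * Real.exp |l|) * C, ENNReal.mul_ne_top ENNReal.ofReal_ne_top hC,
      fun y hy => ?_⟩
    obtain ⟨f, g, hf, hg, e, hle⟩ := K y hy
    refine ⟨modT (c * Complex.exp (-(l * y : ℝ))) l a f, modT (c * Complex.exp (-(l * y : ℝ))) l a g,
      modT_meas hf, modT_meas hg, ?_, ?_⟩
    · rw [modH_line, ← e]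
      ext x
      simp only [modT, Pi.add_apply]
      ring
    · rw [modT_norm _ _ _ hf.aestronglyMeasurable, modT_norm _ _ _ hg.aestronglyMeasurable]
      have hb : ‖c * Complex.exp (-(l * y : ℝ))‖ₑ ≤ ENNReal.ofReal (‖c‖ * Real.exp |l|) := by
        rw [← ofReal_norm]
        refine ENNReal.ofReal_le_ofReal ?_
        rw [norm_mul, Complex.norm_exp]
        gcongr
        simp only [Complex.neg_re, Complex.ofReal_re]
        calc -(l * y) ≤ |l * y| := neg_le_abs _
          _ = |l| * y := by rw [abs_mul, abs_of_pos hy.1]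
          _ ≤ |l| * 1 := by gcongr; exact hy.2.le
          _ = |l| := mul_one _
      calc _ = ‖c * Complex.exp (-(l * y : ℝ))‖ₑ * (ENNReal.ofReal (1 - y)⁻¹ * eLpNorm f p volume +
        ENNReal.ofReal y⁻¹ * eLpNorm g q volume) := by ring
        _ ≤ _ := by gcongr

lemma Adm.mod {p q : ℝ≥0∞} {h : ℂ → ℂ} {h0 h1 : ℝ → ℂ} (H : Adm p q h h0 h1) (c : ℂ) (l a : ℝ) :
    Adm p q (modH c l a h) (modT (c * Complex.exp (-(l * (0:ℝ) : ℝ))) l a h0)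
      (modT (c * Complex.exp (-(l * (1:ℝ) : ℝ))) l a h1) where
  hardy := modH_hardy c l a H.hardy
  t0 := modH_trace c l a h h0 _ 0 nhdsWithin_le_nhds H.t0
  t1 := modH_trace c l a h h1 _ 1 nhdsWithin_le_nhds H.t1
  m0 := ⟨modT_aesm H.m0.1, by
    rw [modT_norm _ _ _ H.m0.1]; exact ENNReal.mul_lt_top enorm_lt_top H.m0.2⟩
  m1 := ⟨modT_aesm H.m1.1, by
    rw [modT_norm _ _ _ H.m1.1]; exact ENNReal.mul_lt_top enorm_lt_top H.m1.2⟩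

/-- two-parameter rescaling -/
lemma Adm.rescale {p q : ℝ≥0∞} {h : ℂ → ℂ} {h0 h1 : ℝ → ℂ} (H : Adm p q h h0 h1) (α : ℝ)
    (a s t : ℝ) (hs : 0 < s) (ht : 0 < t) :
    ∃ (h' : ℂ → ℂ) (h0' h1' : ℝ → ℂ), Adm p q h' h0' h1' ∧
      (h' (α * Complex.I)).re = s ^ (1 - α) * t ^ α * ‖bLine h α a‖ ∧
      (eLpNorm h0' p volume).toReal = s * (eLpNorm h0 p volume).toReal ∧
      (eLpNorm h1' q volume).toReal = t * (eLpNorm h1 q volume).toReal := by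
  obtain ⟨u, hu, hu'⟩ : ∃ u : ℂ, ‖u‖ = 1 ∧ u * bLine h α a = ‖bLine h α a‖ := by
    rcases eq_or_ne (bLine h α a) 0 with h0 | h0
    · exact ⟨1, by simp, by simp [h0]⟩
    · have hn : ‖bLine h α a‖ ≠ 0 := norm_ne_zero_iff.2 h0
      have hn' : (‖bLine h α a‖ : ℂ) ≠ 0 := by exact_mod_cast hn
      refine ⟨(starRingEnd ℂ) (bLine h α a) / ‖bLine h α a‖, ?_, ?_⟩
      · simp [hn]
      · field_simp
        rw [Complex.conj_mul']
  set l := Real.log s - Real.log t with hl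
  refine ⟨_, _, _, H.mod (s * u) l a, ?_, ?_, ?_⟩
  · have e1 := congrFun (modH_line (s * u) l a h α) 0
    have e2 : modH (s * u) l a h (α * Complex.I) = bLine (modH (s * u) l a h) α 0 := by
      simp [bLine]
    rw [e2, e1]
    have e3 : modT (s * u * Complex.exp (-(l * α : ℝ))) l a (bLine h α) 0 =
        ((s * Real.exp (-(l * α)) * ‖bLine h α a‖ : ℝ) : ℂ) := by
      simp only [modT]
      push_cast
      rw [← hu']
      simp
      ring
    rw [e3, Complex.ofReal_re]
    congr 1
    rw [Real.rpow_def_of_pos hs, Real.rpow_def_of_pos ht, ← Real.exp_add]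
    nth_rewrite 1 [← Real.exp_log hs]
    rw [← Real.exp_add]
    congr 1
    rw [hl]; ring
  · rw [modT_norm _ _ _ H.m0.1, ENNReal.toReal_mul]
    simp [hu, abs_of_pos hs]
  · rw [modT_norm _ _ _ H.m1.1, ENNReal.toReal_mul]
    congr 1
    simp only [mul_one, toReal_enorm, norm_mul, hu, Complex.norm_exp]
    simp only [Complex.norm_real, Real.norm_eq_abs, abs_of_pos hs, Complex.neg_re, Complex.ofReal_re]
    rw [hl, neg_sub, Real.exp_sub, Real.exp_log hs, Real.exp_log ht]
    field_simp

lemma integrable_mul_schwartz {p : ℝ≥0∞} (hp : 1 ≤ p) {f : ℝ → ℂ} (hf : MemLp f p volume)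
    (φ : SchwartzMap ℝ ℂ) : Integrable (fun x => f x * (starRingEnd ℂ) (φ x)) volume := by
  have := ENNReal.HolderConjugate.conjExponent hp
  exact hf.integrable_mul (q := ENNReal.conjExponent p) (φ.memLp _ volume).star

lemma MemHardy.integrable {p q : ℝ≥0∞} (hp : 1 ≤ p) (hq : 1 ≤ q) {h : ℂ → ℂ}
    (H : MemHardy p q h) {y : ℝ} (hy : y ∈ Set.Ioo (0:ℝ) 1) (φ : SchwartzMap ℝ ℂ) :
    Integrable (fun x : ℝ => h (x + y * Complex.I) * (starRingEnd ℂ) (φ x)) volume := by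
  obtain ⟨C, hC, K⟩ := H.split
  obtain ⟨f, g, hf, hg, e, h1, h2⟩ := K y hy
  have i1 := integrable_mul_schwartz hp (f := f) ⟨hf.aestronglyMeasurable, h1.trans_lt hC.lt_top⟩ φ
  have i2 := integrable_mul_schwartz hq (f := g) ⟨hg.aestronglyMeasurable, h2.trans_lt hC.lt_top⟩ φ
  refine (i1.add i2).congr (ae_of_all _ fun x => ?_)
  have := congrFun e x
  simp only [Pi.add_apply, bLine] at this ⊢
  rw [← this]; ring

lemma MemHardy.add {p q : ℝ≥0∞} (hp : 1 ≤ p) (hq : 1 ≤ q) {h k : ℂ → ℂ}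
    (H : MemHardy p q h) (K : MemHardy p q k) : MemHardy p q (fun z => h z + k z) := by
  refine ⟨H.1.add K.1, ?_⟩
  obtain ⟨C, hC, hK⟩ := (hardyNorm_lt_top_iff p q h).1 H.2
  obtain ⟨C', hC', hK'⟩ := (hardyNorm_lt_top_iff p q k).1 K.2
  refine (hardyNorm_lt_top_iff p q _).2 ⟨C + C', by simp [hC, hC'], fun y hy => ?_⟩
  obtain ⟨f, g, hf, hg, e, hle⟩ := hK y hy
  obtain ⟨f', g', hf', hg', e', hle'⟩ := hK' y hy
  refine ⟨f + f', g + g', hf.add hf', hg.add hg', ?_, ?_⟩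
  · have : bLine (fun z => h z + k z) y = bLine h y + bLine k y := rfl
    rw [this, ← e, ← e']; abel
  · calc _ ≤ ENNReal.ofReal (1 - y)⁻¹ * (eLpNorm f p volume + eLpNorm f' p volume) +
        ENNReal.ofReal y⁻¹ * (eLpNorm g q volume + eLpNorm g' q volume) := by
          gcongr
          · exact eLpNorm_add_le hf.aestronglyMeasurable hf'.aestronglyMeasurable hp
          · exact eLpNorm_add_le hg.aestronglyMeasurable hg'.aestronglyMeasurable hq
      _ = _ := by ring
      _ ≤ _ := add_le_add hle hle'

lemma trace_add {p q r : ℝ≥0∞} (hp : 1 ≤ p) (hq : 1 ≤ q) (hr : 1 ≤ r) {h k : ℂ → ℂ}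
    {v w : ℝ → ℂ}
    (H : MemHardy p q h) (K : MemHardy p q k) (F : Filter ℝ) (hF : ∀ᶠ y in F, y ∈ Set.Ioo (0:ℝ) 1)
    (hv : MemLp v r volume) (hw : MemLp w r volume)
    (h1 : ∀ φ : SchwartzMap ℝ ℂ,
      Tendsto (fun y : ℝ => ∫ x : ℝ, h (x + y * Complex.I) * (starRingEnd ℂ) (φ x))
      F (𝓝 (∫ x : ℝ, v x * (starRingEnd ℂ) (φ x))))
    (h2 : ∀ φ : SchwartzMap ℝ ℂ,
      Tendsto (fun y : ℝ => ∫ x : ℝ, k (x + y * Complex.I) * (starRingEnd ℂ) (φ x))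
      F (𝓝 (∫ x : ℝ, w x * (starRingEnd ℂ) (φ x)))) (φ : SchwartzMap ℝ ℂ) :
    Tendsto (fun y : ℝ => ∫ x : ℝ, (fun z => h z + k z) (x + y * Complex.I) * (starRingEnd ℂ) (φ x))
      F (𝓝 (∫ x : ℝ, (v + w) x * (starRingEnd ℂ) (φ x))) := by
  have e : ∫ x : ℝ, (v + w) x * (starRingEnd ℂ) (φ x) =
      (∫ x : ℝ, v x * (starRingEnd ℂ) (φ x)) + ∫ x : ℝ, w x * (starRingEnd ℂ) (φ x) := by
    rw [← integral_add (integrable_mul_schwartz hr hv φ) (integrable_mul_schwartz hr hw φ)]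
    congr 1
    ext x
    simp [add_mul]
  rw [e]
  refine ((h1 φ).add (h2 φ)).congr' ?_
  filter_upwards [hF] with y hy
  rw [← integral_add (H.integrable hp hq hy φ) (K.integrable hp hq hy φ)]
  congr 1
  ext x
  ring

lemma Adm.add {p q : ℝ≥0∞} (hp : 1 ≤ p) (hq : 1 ≤ q) {h k : ℂ → ℂ} {h0 h1 k0 k1 : ℝ → ℂ}
    (H : Adm p q h h0 h1) (K : Adm p q k k0 k1) :
    Adm p q (fun z => h z + k z) (h0 + k0) (h1 + k1) where
  hardy := H.hardy.add hp hq K.hardy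
  t0 := trace_add hp hq hp H.hardy K.hardy _ (Ioo_mem_nhdsGT one_pos) H.m0 K.m0 H.t0 K.t0
  t1 := trace_add hp hq hq H.hardy K.hardy _ (Ioo_mem_nhdsLT one_pos) H.m1 K.m1 H.t1 K.t1
  m0 := H.m0.add K.m0
  m1 := H.m1.add K.m1

/-- the gaussian -/
def gauss (z : ℂ) : ℂ := Complex.exp (-z ^ 2)

lemma gauss_norm (x y : ℝ) : ‖gauss (x + y * Complex.I)‖ = Real.exp (y ^ 2) * Real.exp (-1 * x ^ 2) := by
  rw [gauss, Complex.norm_exp, ← Real.exp_add]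
  congr 1
  simp [pow_two]
  ring

lemma memLp_gaussR (p : ℝ≥0∞) (hp : 1 ≤ p) :
    MemLp (fun x : ℝ => Real.exp (-1 * x ^ 2)) p volume := by
  have hm : AEStronglyMeasurable (fun x : ℝ => Real.exp (-1 * x ^ 2)) volume :=
    Continuous.aestronglyMeasurable (by fun_prop)
  rcases eq_or_ne p ⊤ with rfl | hpt
  · refine memLp_top_of_bound hm 1 (ae_of_all _ fun x => ?_)
    rw [Real.norm_eq_abs, Real.abs_exp, Real.exp_le_one_iff]
    nlinarith [sq_nonneg x]
  · have hp0 : p ≠ 0 := (one_pos.trans_le hp).ne'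
    have hpos : 0 < p.toReal := ENNReal.toReal_pos hp0 hpt
    rw [← integrable_norm_rpow_iff hm hp0 hpt]
    refine (integrable_exp_neg_mul_sq hpos).congr (ae_of_all _ fun x => ?_)
    simp only [Real.norm_eq_abs, Real.abs_exp]
    rw [← Real.exp_mul]
    congr 1; ring

lemma gauss_le (x y : ℝ) (hy : y ∈ Set.Icc (0:ℝ) 1) :
    ‖gauss (x + y * Complex.I)‖ ≤ Real.exp 1 * Real.exp (-1 * x ^ 2) := by
  rw [gauss_norm]
  gcongr
  nlinarith [hy.1, hy.2]

lemma gauss_cont_line (y : ℝ) : Continuous (bLine gauss y) := by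
  unfold bLine gauss; fun_prop

lemma gauss_memLp (p : ℝ≥0∞) (hp : 1 ≤ p) (y : ℝ) (hy : y ∈ Set.Icc (0:ℝ) 1) :
    MemLp (bLine gauss y) p volume := by
  refine MemLp.mono ((memLp_gaussR p hp).const_mul (Real.exp 1))
    (gauss_cont_line y).aestronglyMeasurable (ae_of_all _ fun x => ?_)
  refine (gauss_le x y hy).trans (le_abs_self _)

lemma gauss_eLp_le (p : ℝ≥0∞) (y : ℝ) (hy : y ∈ Set.Icc (0:ℝ) 1) :
    eLpNorm (bLine gauss y) p volume ≤
      eLpNorm (fun x : ℝ => Real.exp 1 * Real.exp (-1 * x ^ 2)) p volume :=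
  eLpNorm_mono_real fun x => gauss_le x y hy

lemma gauss_hardy {p q : ℝ≥0∞} (hp : 1 ≤ p) (hq : 1 ≤ q) : MemHardy p q gauss := by
  refine ⟨by unfold gauss; fun_prop, ?_⟩
  rw [hardyNorm_lt_top_iff]
  refine ⟨eLpNorm (fun x : ℝ => Real.exp 1 * Real.exp (-1 * x ^ 2)) p volume +
    eLpNorm (fun x : ℝ => Real.exp 1 * Real.exp (-1 * x ^ 2)) q volume,
    ENNReal.add_ne_top.2 ⟨((memLp_gaussR p hp).const_mul (Real.exp 1)).2.ne,
      ((memLp_gaussR q hq).const_mul (Real.exp 1)).2.ne⟩, fun y hy => ?_⟩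
  have hy' : y ∈ Set.Icc (0:ℝ) 1 := ⟨hy.1.le, hy.2.le⟩
  have hm := (gauss_cont_line y).measurable
  refine ⟨((1 - y : ℝ) : ℂ) • bLine gauss y, (y : ℂ) • bLine gauss y, hm.const_smul _,
    hm.const_smul _, ?_, ?_⟩
  · rw [← add_smul]; simp
  · have aux : ∀ t : ℝ, 0 < t → ENNReal.ofReal t⁻¹ * ‖(t : ℂ)‖ₑ = 1 := by
      intro t ht
      rw [← ofReal_norm, Complex.norm_real, Real.norm_eq_abs, abs_of_pos ht,
        ← ENNReal.ofReal_mul (by positivity), inv_mul_cancel₀ ht.ne', ENNReal.ofReal_one]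
    rw [eLpNorm_const_smul, eLpNorm_const_smul, ← mul_assoc, ← mul_assoc,
      aux _ (by linarith [hy.2]), aux _ hy.1, one_mul, one_mul]
    exact add_le_add (gauss_eLp_le p y hy') (gauss_eLp_le q y hy')

lemma gauss_trace (F : Filter ℝ) [F.IsCountablyGenerated] (y₀ : ℝ) (hF : F ≤ 𝓝 y₀)
    (hF' : ∀ᶠ y in F, y ∈ Set.Ioo (0:ℝ) 1) (φ : SchwartzMap ℝ ℂ) :
    Tendsto (fun y : ℝ => ∫ x : ℝ, gauss (x + y * Complex.I) * (starRingEnd ℂ) (φ x))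
      F (𝓝 (∫ x : ℝ, bLine gauss y₀ x * (starRingEnd ℂ) (φ x))) := by
  refine tendsto_integral_filter_of_dominated_convergence
    (fun x => Real.exp 1 * ‖φ x‖) ?_ ?_ ?_ ?_
  · refine Eventually.of_forall fun y => Continuous.aestronglyMeasurable ?_
    have := gauss_cont_line y
    exact this.mul (Complex.continuous_conj.comp φ.continuous)
  · filter_upwards [hF'] with y hy
    refine ae_of_all _ fun x => ?_
    rw [norm_mul, RCLike.norm_conj]
    gcongr
    refine (gauss_le x y ⟨hy.1.le, hy.2.le⟩).trans ?_
    have : Real.exp (-1 * x ^ 2) ≤ 1 := by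
      rw [Real.exp_le_one_iff]; nlinarith [sq_nonneg x]
    nlinarith [Real.exp_pos 1]
  · exact (φ.integrable.norm).const_mul _
  · refine ae_of_all _ fun x => Tendsto.mul_const _ ?_
    have : Continuous (fun y : ℝ => gauss (x + y * Complex.I)) := by unfold gauss; fun_prop
    exact (this.tendsto y₀).mono_left hF

lemma gauss_adm {p q : ℝ≥0∞} (hp : 1 ≤ p) (hq : 1 ≤ q) :
    Adm p q gauss (bLine gauss 0) (bLine gauss 1) where
  hardy := gauss_hardy hp hq
  t0 := gauss_trace _ 0 nhdsWithin_le_nhds (Ioo_mem_nhdsGT one_pos)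
  t1 := gauss_trace _ 1 nhdsWithin_le_nhds (Ioo_mem_nhdsLT one_pos)
  m0 := gauss_memLp p hp 0 (by simp)
  m1 := gauss_memLp q hq 1 (by simp)

lemma gauss_pos (p : ℝ≥0∞) (hp : 1 ≤ p) (y : ℝ) (hy : y ∈ Set.Icc (0:ℝ) 1) :
    0 < (eLpNorm (bLine gauss y) p volume).toReal := by
  refine ENNReal.toReal_pos ?_ (gauss_memLp p hp y hy).2.ne
  rw [Ne, eLpNorm_eq_zero_iff (gauss_cont_line y).aestronglyMeasurable (one_pos.trans_le hp).ne']
  intro h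
  have h2 := h.exists
  obtain ⟨x, hx⟩ := h2
  simp [bLine, gauss] at hx

lemma zero_adm {p q : ℝ≥0∞} (hp : 1 ≤ p) (hq : 1 ≤ q) :
    Adm p q (modH 0 0 0 gauss) (modT (0 * Complex.exp (-(0 * (0:ℝ) : ℝ))) 0 0 (bLine gauss 0))
      (modT (0 * Complex.exp (-(0 * (1:ℝ) : ℝ))) 0 0 (bLine gauss 1)) :=
  (gauss_adm hp hq).mod 0 0 0

lemma toReal_eLp_tri {p : ℝ≥0∞} (hp : 1 ≤ p) {f g : ℝ → ℂ} (hf : MemLp f p volume)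
    (hg : MemLp g p volume) :
    (eLpNorm (f + g) p volume).toReal ≤ (eLpNorm f p volume).toReal + (eLpNorm g p volume).toReal ∧
    (eLpNorm f p volume).toReal ≤ (eLpNorm (f + g) p volume).toReal + (eLpNorm g p volume).toReal ∧
    (eLpNorm g p volume).toReal ≤
      (eLpNorm (f + g) p volume).toReal + (eLpNorm f p volume).toReal := by
  have hfg := hf.add hg
  refine ⟨?_, ?_, ?_⟩
  · rw [← ENNReal.toReal_add hf.2.ne hg.2.ne]
    exact ENNReal.toReal_mono (ENNReal.add_ne_top.2 ⟨hf.2.ne, hg.2.ne⟩)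
      (eLpNorm_add_le hf.1 hg.1 hp)
  · rw [← ENNReal.toReal_add hfg.2.ne hg.2.ne]
    refine ENNReal.toReal_mono (ENNReal.add_ne_top.2 ⟨hfg.2.ne, hg.2.ne⟩) ?_
    have := eLpNorm_sub_le hfg.1 hg.1 hp
    rwa [add_sub_cancel_right] at this
  · rw [← ENNReal.toReal_add hfg.2.ne hf.2.ne]
    refine ENNReal.toReal_mono (ENNReal.add_ne_top.2 ⟨hfg.2.ne, hf.2.ne⟩) ?_
    have := eLpNorm_sub_le hfg.1 hf.1 hp
    rwa [add_sub_cancel_left] at this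

lemma ratio_unbounded {p q : ℝ≥0∞} (hp : 1 ≤ p) (hq : 1 ≤ q) {α : ℝ} (hα : α ∈ Set.Ioo (0:ℝ) 1)
    {h : ℂ → ℂ} {h0 h1 : ℝ → ℂ} (H : Adm p q h h0 h1) (a : ℝ) (ha : bLine h α a ≠ 0)
    (hz : (eLpNorm h0 p volume).toReal = 0 ∨ (eLpNorm h1 q volume).toReal = 0) :
    ¬ BddAbove (ratioSet p q α) := by
  rintro ⟨R, hR⟩
  set A := (eLpNorm h0 p volume).toReal with hA
  set B := (eLpNorm h1 q volume).toReal with hB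
  have hA0 : 0 ≤ A := ENNReal.toReal_nonneg
  have hB0 : 0 ≤ B := ENNReal.toReal_nonneg
  have hK0 := gauss_pos p hp 0 (by simp)
  have hK1 := gauss_pos q hq 1 (by simp)
  set K0 := (eLpNorm (bLine gauss 0) p volume).toReal
  set K1 := (eLpNorm (bLine gauss 1) q volume).toReal
  set m := ‖bLine h α a‖ with hm
  have hmpos : 0 < m := norm_pos_iff.2 ha
  set G := ‖bLine gauss α a‖ with hG
  have hα1 := hα.1
  have hα2 := hα.2
  have small : ∀ (X K : ℝ), 0 ≤ X → 0 < K → ∀ᶠ ε in 𝓝[>] (0:ℝ), X = 0 ∨ ε * K < X := by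
    intro X K hX hK
    rcases hX.eq_or_lt with h | h
    · exact Eventually.of_forall fun _ => Or.inl h.symm
    · have : Tendsto (fun ε : ℝ => ε * K) (𝓝[>] 0) (𝓝 0) := by
        have : Continuous (fun ε : ℝ => ε * K) := by fun_prop
        have := (this.tendsto 0).mono_left (nhdsWithin_le_nhds (s := Set.Ioi 0))
        simpa using this
      filter_upwards [this.eventually_lt_const h] with ε hε
      exact Or.inr hε
  have hev : ∀ᶠ ε in 𝓝[>] (0:ℝ), m - ε * G ≤
      |R| * ((A + ε * K0) ^ (1 - α) * (B + ε * K1) ^ α) := by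
    filter_upwards [small A K0 hA0 hK0, small B K1 hB0 hK1, self_mem_nhdsWithin] with ε e1 e2 hε
    have hε : 0 < ε := hε
    have hk := (gauss_adm hp hq).mod (ε : ℂ) 0 0
    have hs := H.add hp hq hk
    have n0 : (eLpNorm (modT ((ε : ℂ) * Complex.exp (-((0:ℝ) * (0:ℝ) : ℝ))) 0 0 (bLine gauss 0)) p
        volume).toReal = ε * K0 := by
      rw [modT_norm _ _ _ (gauss_cont_line 0).aestronglyMeasurable, ENNReal.toReal_mul]
      simp [abs_of_pos hε, K0]
    have n1 : (eLpNorm (modT ((ε : ℂ) * Complex.exp (-((0:ℝ) * (1:ℝ) : ℝ))) 0 0 (bLine gauss 1)) q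
        volume).toReal = ε * K1 := by
      rw [modT_norm _ _ _ (gauss_cont_line 1).aestronglyMeasurable, ENNReal.toReal_mul]
      simp [abs_of_pos hε, K1]
    obtain ⟨t1, t2, t3⟩ := toReal_eLp_tri hp H.m0 hk.m0
    obtain ⟨u1, u2, u3⟩ := toReal_eLp_tri hq H.m1 hk.m1
    rw [n0] at t1 t2 t3
    rw [n1] at u1 u2 u3
    set k0 := modT ((ε : ℂ) * Complex.exp (-((0:ℝ) * (0:ℝ) : ℝ))) 0 0 (bLine gauss 0)
    set k1 := modT ((ε : ℂ) * Complex.exp (-((0:ℝ) * (1:ℝ) : ℝ))) 0 0 (bLine gauss 1)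
    have hεK0 : 0 < ε * K0 := mul_pos hε hK0
    have hεK1 : 0 < ε * K1 := mul_pos hε hK1
    have pA : 0 < (eLpNorm (h0 + k0) p volume).toReal := by
      rcases e1 with e1 | e1 <;> linarith
    have pB : 0 < (eLpNorm (h1 + k1) q volume).toReal := by
      rcases e2 with e2 | e2 <;> linarith
    have hline : bLine (fun z => h z + modH (ε : ℂ) 0 0 gauss z) α a =
        bLine h α a + ε * bLine gauss α a := by
      simp [bLine, modH]
    have hmG : m - ε * G ≤ ‖bLine (fun z => h z + modH (ε : ℂ) 0 0 gauss z) α a‖ := by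
      rw [hline]
      have := norm_sub_le (bLine h α a + ε * bLine gauss α a) (ε * bLine gauss α a)
      rw [add_sub_cancel_right, norm_mul, Complex.norm_real, Real.norm_eq_abs, abs_of_pos hε] at this
      linarith
    have hpos : 0 ≤ |R| * ((A + ε * K0) ^ (1 - α) * (B + ε * K1) ^ α) := by positivity
    by_cases hne : bLine (fun z => h z + modH (ε : ℂ) 0 0 gauss z) α a = 0
    · rw [hne, norm_zero] at hmG
      linarith
    have hr := hR ⟨_, _, _, hs.hardy, ⟨_, mem_Strip_line hα, hne⟩, hs.t0, hs.t1, hs.m0, hs.m1, rfl⟩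
    have hD : 0 < (eLpNorm (h0 + k0) p volume).toReal ^ (1 - α) *
        (eLpNorm (h1 + k1) q volume).toReal ^ α := by positivity
    rw [div_le_iff₀ hD] at hr
    refine hmG.trans (((hs.hardy.line_sup hp hq hα).1 a).trans (hr.trans ?_))
    calc _ ≤ |R| * ((eLpNorm (h0 + k0) p volume).toReal ^ (1 - α) *
        (eLpNorm (h1 + k1) q volume).toReal ^ α) := by gcongr; exact le_abs_self R
      _ ≤ _ := by
        gcongr
  have hlim : Tendsto (fun ε : ℝ => |R| * ((A + ε * K0) ^ (1 - α) * (B + ε * K1) ^ α))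
      (𝓝[>] 0) (𝓝 0) := by
    have hc : Continuous (fun ε : ℝ => |R| * ((A + ε * K0) ^ (1 - α) * (B + ε * K1) ^ α)) := by
      refine continuous_const.mul (Continuous.mul ?_ ?_)
      · exact Continuous.rpow_const (by fun_prop) fun _ => Or.inr (by linarith)
      · exact Continuous.rpow_const (by fun_prop) fun _ => Or.inr (by linarith)
    have := (hc.tendsto 0).mono_left (nhdsWithin_le_nhds (s := Set.Ioi 0))
    convert this using 2
    rcases hz with h | h
    · simp [h, Real.zero_rpow (by linarith : (1 - α) ≠ 0)]
    · simp [h, Real.zero_rpow hα1.ne']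
  have hlim2 : Tendsto (fun ε : ℝ => m - ε * G) (𝓝[>] 0) (𝓝 m) := by
    have hc : Continuous (fun ε : ℝ => m - ε * G) := by fun_prop
    have := (hc.tendsto 0).mono_left (nhdsWithin_le_nhds (s := Set.Ioi 0))
    simpa using this
  exact absurd (le_of_tendsto_of_tendsto hlim2 hlim hev) (not_le.2 hmpos)

lemma young_aux {α r₀ r₁ rα rαs : ℝ} (hα : α ∈ Set.Ioo (0:ℝ) 1) (hr₀ : 1 < r₀) (hr₁ : 1 < r₁)
    (hrα : rα⁻¹ = (1 - α) / r₀ + α / r₁) (hrαs : rαs = rα / (rα - 1)) :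
    rα.HolderConjugate rαs := by
  have hα1 := hα.1
  have hα2 := hα.2
  have h1 : 0 < rα⁻¹ := by
    rw [hrα]
    have : 0 < 1 - α := by linarith
    positivity
  have h2 : rα⁻¹ < 1 := by
    rw [hrα]
    have a1 : (1 - α) / r₀ < 1 - α := div_lt_self (by linarith) hr₀
    have a2 : α / r₁ < α := div_lt_self hα1 hr₁
    linarith
  have h3 : 1 < rα := by
    have := (one_lt_inv₀ h1).2 h2
    rwa [inv_inv] at this
  rw [Real.holderConjugate_iff_eq_conjExponent h3]
  exact hrαs

lemma upper_aux {α r₀ r₁ rα rαs : ℝ} (hα : α ∈ Set.Ioo (0:ℝ) 1) (hr₀ : 1 < r₀) (hr₁ : 1 < r₁)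
    (hrα : rα⁻¹ = (1 - α) / r₀ + α / r₁) (hc : rα.HolderConjugate rαs)
    {A B m M : ℝ} (hA : 0 < A) (hB : 0 < B) (hM : 0 ≤ M) (hm : m ≤ M) :
    m - (α / r₁) * B ^ r₁ - ((1 - α) / r₀) * A ^ r₀ ≤
      (1 / rαs) * (M / (A ^ (1 - α) * B ^ α)) ^ rαs := by
  have hα1 := hα.1
  have hα2 : 0 < 1 - α := by linarith [hα.2]
  have hrpos : 0 < rα := hc.pos
  set D := A ^ (1 - α) * B ^ α with hD
  have hDpos : 0 < D := by positivity
  have hy := Real.young_inequality_of_nonneg hDpos.le (div_nonneg hM hDpos.le) hc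
  rw [mul_div_cancel₀ _ hDpos.ne'] at hy
  have hw : (rα * ((1 - α) / r₀)) + (rα * (α / r₁)) = 1 := by
    rw [← mul_add, ← hrα, mul_inv_cancel₀ hrpos.ne']
  have hg := Real.geom_mean_le_arith_mean2_weighted
    (w₁ := rα * ((1 - α) / r₀)) (w₂ := rα * (α / r₁)) (p₁ := A ^ r₀) (p₂ := B ^ r₁)
    (by positivity) (by positivity) (by positivity) (by positivity) hw
  have e : (A ^ r₀) ^ (rα * ((1 - α) / r₀)) * (B ^ r₁) ^ (rα * (α / r₁)) = D ^ rα := by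
    rw [hD, Real.mul_rpow (by positivity) (by positivity), ← Real.rpow_mul hA.le,
      ← Real.rpow_mul hB.le, ← Real.rpow_mul hA.le, ← Real.rpow_mul hB.le]
    congr 2 <;> field_simp
  rw [e] at hg
  have hg' : D ^ rα / rα ≤ ((1 - α) / r₀) * A ^ r₀ + (α / r₁) * B ^ r₁ := by
    rw [div_le_iff₀ hrpos]
    linarith
  rw [one_div, inv_mul_eq_div]
  linarith

lemma lower_aux {α r₀ r₁ rα rαs : ℝ} (hr₀ : 1 < r₀) (hr₁ : 1 < r₁)
    (hrα : rα⁻¹ = (1 - α) / r₀ + α / r₁) (hc : rα.HolderConjugate rαs)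
    {A B m : ℝ} (hA : 0 < A) (hB : 0 < B) (hm : 0 < m) :
    ∃ s t : ℝ, 0 < s ∧ 0 < t ∧
      s ^ (1 - α) * t ^ α * m - (α / r₁) * (t * B) ^ r₁ - ((1 - α) / r₀) * (s * A) ^ r₀ =
      (1 / rαs) * (m / (A ^ (1 - α) * B ^ α)) ^ rαs := by
  have hrpos : 0 < rα := hc.pos
  have hr₀' : r₀ ≠ 0 := by linarith
  have hr₁' : r₁ ≠ 0 := by linarith
  set D := A ^ (1 - α) * B ^ α with hD
  have hDpos : 0 < D := by positivity
  set σ := m / D with hσ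
  have hσpos : 0 < σ := by positivity
  set u := σ ^ rαs with hu
  have hupos : 0 < u := by positivity
  refine ⟨u ^ r₀⁻¹ / A, u ^ r₁⁻¹ / B, by positivity, by positivity, ?_⟩
  rw [div_mul_cancel₀ _ hA.ne', div_mul_cancel₀ _ hB.ne', Real.rpow_inv_rpow hupos.le hr₀',
    Real.rpow_inv_rpow hupos.le hr₁', Real.div_rpow (by positivity) hA.le,
    Real.div_rpow (by positivity) hB.le, ← Real.rpow_mul hupos.le, ← Real.rpow_mul hupos.le]
  have e1 : u ^ (r₀⁻¹ * (1 - α)) / A ^ (1 - α) * (u ^ (r₁⁻¹ * α) / B ^ α) * m = u ^ rα⁻¹ * σ := by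
    rw [div_mul_div_comm, ← Real.rpow_add hupos, hσ, hD, hrα]
    rw [div_mul_eq_mul_div, mul_div_assoc]
    congr 2
    ring
  have e2 : u ^ rα⁻¹ * σ = u := by
    rw [hu, ← Real.rpow_mul hσpos.le]
    nth_rewrite 2 [← Real.rpow_one σ]
    rw [← Real.rpow_add hσpos]
    congr 1
    have h1 := hc.inv_add_inv_eq_one
    have h2 : rαs ≠ 0 := hc.symm.pos.ne'
    have h3 : rα⁻¹ = 1 - rαs⁻¹ := by linarith
    rw [h3]
    field_simp
    ring
  rw [e1, e2]
  have h1 := hc.inv_add_inv_eq_one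
  rw [hrα] at h1
  have h2 : 1 / rαs = 1 - ((1 - α) / r₀ + α / r₁) := by rw [one_div]; linarith
  rw [h2]
  ring

def Eset (p q : ℝ≥0∞) (α r₀ r₁ : ℝ) : Set ℝ :=
  { e : ℝ | ∃ (h : ℂ → ℂ) (h0 h1 : ℝ → ℂ), MemHardy p q h ∧
        IsTrace0 h h0 ∧ IsTrace1 h h1 ∧ MemLp h0 p volume ∧ MemLp h1 q volume ∧
        e = (h ((α : ℂ) * Complex.I)).re -
            (α / r₁) * (eLpNorm h1 q volume).toReal ^ r₁ -
            ((1 - α) / r₀) * (eLpNorm h0 p volume).toReal ^ r₀ }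

lemma Adm.mem_Eset {p q : ℝ≥0∞} {h : ℂ → ℂ} {h0 h1 : ℝ → ℂ} (H : Adm p q h h0 h1) (α r₀ r₁ : ℝ) :
    (h ((α : ℂ) * Complex.I)).re -
            (α / r₁) * (eLpNorm h1 q volume).toReal ^ r₁ -
            ((1 - α) / r₀) * (eLpNorm h0 p volume).toReal ^ r₀ ∈ Eset p q α r₀ r₁ :=
  ⟨h, h0, h1, H.hardy, H.t0, H.t1, H.m0, H.m1, rfl⟩

lemma Adm.mem_Eset' {p q : ℝ≥0∞} {h : ℂ → ℂ} {h0 h1 : ℝ → ℂ} (H : Adm p q h h0 h1) (α r₀ r₁ : ℝ)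
    (a s t : ℝ) (hs : 0 < s) (ht : 0 < t) :
    s ^ (1 - α) * t ^ α * ‖bLine h α a‖ -
            (α / r₁) * (t * (eLpNorm h1 q volume).toReal) ^ r₁ -
            ((1 - α) / r₀) * (s * (eLpNorm h0 p volume).toReal) ^ r₀ ∈ Eset p q α r₀ r₁ := by
  obtain ⟨h', h0', h1', H', e1, e2, e3⟩ := H.rescale α a s t hs ht
  have := H'.mem_Eset α r₀ r₁
  rwa [e1, e2, e3] at this

lemma Eset_unbounded {p q : ℝ≥0∞} {α r₀ r₁ : ℝ} (hα : α ∈ Set.Ioo (0:ℝ) 1) (hr₀ : 1 < r₀)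
    (hr₁ : 1 < r₁)
    {h : ℂ → ℂ} {h0 h1 : ℝ → ℂ} (H : Adm p q h h0 h1) (a : ℝ) (ha : bLine h α a ≠ 0)
    (hz : (eLpNorm h0 p volume).toReal = 0 ∨ (eLpNorm h1 q volume).toReal = 0) :
    ¬ BddAbove (Eset p q α r₀ r₁) := by
  rintro ⟨R, hR⟩
  have hm : 0 < ‖bLine h α a‖ := norm_pos_iff.2 ha
  have hα1 := hα.1
  have hα2 : 0 < 1 - α := by linarith [hα.2]
  rcases hz with hz | hz
  · have hT : Tendsto (fun s : ℝ => s ^ (1 - α) * ‖bLine h α a‖ + -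
        ((α / r₁) * (eLpNorm h1 q volume).toReal ^ r₁)) atTop atTop :=
      tendsto_atTop_add_const_right _ _ ((tendsto_rpow_atTop hα2).atTop_mul_const hm)
    obtain ⟨s, hs, hs0⟩ := ((hT.eventually_gt_atTop R).and (eventually_gt_atTop 0)).exists
    have := hR (H.mem_Eset' α r₀ r₁ a s 1 hs0 one_pos)
    rw [hz, mul_zero, Real.zero_rpow (by linarith), Real.one_rpow, one_mul, mul_one, mul_zero] at this
    linarith
  · have hT : Tendsto (fun t : ℝ => t ^ α * ‖bLine h α a‖ + -
        (((1 - α) / r₀) * (eLpNorm h0 p volume).toReal ^ r₀)) atTop atTop :=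
      tendsto_atTop_add_const_right _ _ ((tendsto_rpow_atTop hα1).atTop_mul_const hm)
    obtain ⟨s, hs, hs0⟩ := ((hT.eventually_gt_atTop R).and (eventually_gt_atTop 0)).exists
    have := hR (H.mem_Eset' α r₀ r₁ a 1 s one_pos hs0)
    rw [hz, mul_zero, Real.zero_rpow (by linarith), Real.one_rpow, one_mul, one_mul, mul_zero] at this
    linarith

/-- **Convex formulation** (Lemma 3.1). -/
theorem convex_formulation (α : ℝ) (hα : α ∈ Set.Ioo (0:ℝ) 1) (p q : ℝ≥0∞)
    (hp : 1 ≤ p) (hq : 1 ≤ q) (r₀ r₁ rα rαs : ℝ) (hr₀ : 1 < r₀) (hr₁ : 1 < r₁)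
    (hrα : rα⁻¹ = (1 - α) / r₀ + α / r₁) (hrαs : rαs = rα / (rα - 1)) :
    sSup { e : ℝ | ∃ (h : ℂ → ℂ) (h0 h1 : ℝ → ℂ), MemHardy p q h ∧
        IsTrace0 h h0 ∧ IsTrace1 h h1 ∧ MemLp h0 p volume ∧ MemLp h1 q volume ∧
        e = (h ((α : ℂ) * Complex.I)).re -
            (α / r₁) * (eLpNorm h1 q volume).toReal ^ r₁ -
            ((1 - α) / r₀) * (eLpNorm h0 p volume).toReal ^ r₀ } =
      (1 / rαs) * Hval p q α ^ rαs := by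
  have hc := young_aux hα hr₀ hr₁ hrα hrαs
  have hspos : 0 < rαs := hc.symm.pos
  show sSup (Eset p q α r₀ r₁) = _
  by_cases hdeg : ∃ (h : ℂ → ℂ) (h0 h1 : ℝ → ℂ) (a : ℝ), Adm p q h h0 h1 ∧ bLine h α a ≠ 0 ∧
      ((eLpNorm h0 p volume).toReal = 0 ∨ (eLpNorm h1 q volume).toReal = 0)
  · obtain ⟨h, h0, h1, a, H, ha, hz⟩ := hdeg
    rw [Hval, Real.sSup_of_not_bddAbove (ratio_unbounded hp hq hα H a ha hz),
      Real.sSup_of_not_bddAbove (Eset_unbounded hα hr₀ hr₁ H a ha hz), Real.zero_rpow hspos.ne',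
      mul_zero]
  have hnz : ∀ (h : ℂ → ℂ) (h0 h1 : ℝ → ℂ) (a : ℝ), Adm p q h h0 h1 → bLine h α a ≠ 0 →
      0 < (eLpNorm h0 p volume).toReal ∧ 0 < (eLpNorm h1 q volume).toReal := by
    intro h h0 h1 a H ha
    by_contra hcon
    refine hdeg ⟨h, h0, h1, a, H, ha, ?_⟩
    by_contra h2
    push Not at h2
    exact hcon ⟨lt_of_le_of_ne ENNReal.toReal_nonneg h2.1.symm,
      lt_of_le_of_ne ENNReal.toReal_nonneg h2.2.symm⟩
  have hr0 : ∀ r ∈ ratioSet p q α, 0 ≤ r := by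
    rintro r ⟨h, h0, h1, -, -, -, -, -, -, rfl⟩
    positivity
  have hH0 : 0 ≤ Hval p q α := Real.sSup_nonneg hr0
  have hE0 : (0:ℝ) ∈ Eset p q α r₀ r₁ := by
    have := (zero_adm hp hq).mem_Eset α r₀ r₁
    rw [modT_norm _ _ _ (gauss_cont_line 0).aestronglyMeasurable,
      modT_norm _ _ _ (gauss_cont_line 1).aestronglyMeasurable] at this
    simpa [modH, Real.zero_rpow (by linarith : r₀ ≠ 0), Real.zero_rpow (by linarith : r₁ ≠ 0)]
      using this
  have hα1 := hα.1
  have hα2 : 0 < 1 - α := by linarith [hα.2]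
  -- lower bounds: an upper bound of `Eset` bounds all ratios
  have hlow : ∀ b, b ∈ upperBounds (Eset p q α r₀ r₁) → ∀ r ∈ ratioSet p q α,
      r ≤ (rαs * b) ^ rαs⁻¹ := by
    rintro b hb r ⟨h, h0, h1, i1, -, i2, i3, i4, i5, rfl⟩
    have H : Adm p q h h0 h1 := ⟨i1, i2, i3, i4, i5⟩
    have hb0 : 0 ≤ b := hb hE0
    have hrhs : 0 ≤ (rαs * b) ^ rαs⁻¹ := by positivity
    by_cases hne : ∃ a, bLine h α a ≠ 0
    · obtain ⟨a₀, ha₀⟩ := hne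
      obtain ⟨hA, hB⟩ := hnz h h0 h1 a₀ H ha₀
      have hD : 0 < (eLpNorm h0 p volume).toReal ^ (1 - α) * (eLpNorm h1 q volume).toReal ^ α := by
        positivity
      rw [div_le_iff₀ hD]
      refine (i1.line_sup hp hq hα).2 _ (by positivity) fun a => ?_
      rcases (norm_nonneg (bLine h α a)).eq_or_lt with hm | hm
      · rw [← hm]; positivity
      · obtain ⟨s, t, hs, ht, e⟩ := lower_aux hr₀ hr₁ hrα hc hA hB hm
        have := hb (H.mem_Eset' α r₀ r₁ a s t hs ht)
        rw [e, one_div, inv_mul_le_iff₀ hspos] at this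
        rw [← div_le_iff₀ hD]
        exact (Real.le_rpow_inv_iff_of_pos (by positivity) (by positivity) hspos).2 this
    · push Not at hne
      have : (eLpNorm (bLine h α) ⊤ volume).toReal ≤ 0 :=
        (i1.line_sup hp hq hα).2 0 le_rfl fun a => by simp [hne a]
      have h0 : (eLpNorm (bLine h α) ⊤ volume).toReal = 0 := le_antisymm this ENNReal.toReal_nonneg
      rw [h0, zero_div]
      exact hrhs
  have hup : BddAbove (ratioSet p q α) → ∀ e ∈ Eset p q α r₀ r₁, e ≤ (1 / rαs) * Hval p q α ^ rαs := by
    rintro hbd e ⟨h, h0, h1, i1, i2, i3, i4, i5, rfl⟩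
    have H : Adm p q h h0 h1 := ⟨i1, i2, i3, i4, i5⟩
    have eb : h (α * Complex.I) = bLine h α 0 := by simp [bLine]
    by_cases ha : bLine h α 0 = 0
    · rw [eb, ha, Complex.zero_re]
      have a1 : 0 ≤ (α / r₁) * (eLpNorm h1 q volume).toReal ^ r₁ := by positivity
      have a2 : 0 ≤ ((1 - α) / r₀) * (eLpNorm h0 p volume).toReal ^ r₀ := by positivity
      have a3 : 0 ≤ (1 / rαs) * Hval p q α ^ rαs := by positivity
      linarith
    · obtain ⟨hA, hB⟩ := hnz h h0 h1 0 H ha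
      have hb := (i1.line_sup hp hq hα).1 0
      have hm : (h (α * Complex.I)).re ≤ (eLpNorm (bLine h α) ⊤ volume).toReal := by
        rw [eb]
        exact (Complex.re_le_norm _).trans hb
      refine (upper_aux hα hr₀ hr₁ hrα hc hA hB ENNReal.toReal_nonneg hm).trans ?_
      gcongr
      exact le_csSup hbd ⟨h, h0, h1, i1, ⟨_, mem_Strip_line hα, ha⟩, i2, i3, i4, i5, rfl⟩
  by_cases hbd : BddAbove (ratioSet p q α)
  · refine le_antisymm (csSup_le ⟨0, hE0⟩ (hup hbd)) ?_
    have hEb : BddAbove (Eset p q α r₀ r₁) := ⟨_, hup hbd⟩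
    have hS0 : 0 ≤ sSup (Eset p q α r₀ r₁) := le_csSup hEb hE0
    have hle : Hval p q α ≤ (rαs * sSup (Eset p q α r₀ r₁)) ^ rαs⁻¹ :=
      Real.sSup_le (hlow _ fun e he => le_csSup hEb he) (by positivity)
    rw [Real.le_rpow_inv_iff_of_pos hH0 (by positivity) hspos] at hle
    rw [one_div, inv_mul_le_iff₀ hspos]
    exact hle
  · have hEb : ¬ BddAbove (Eset p q α r₀ r₁) := fun ⟨b, hb⟩ => hbd ⟨_, hlow b hb⟩
    rw [Hval, Real.sSup_of_not_bddAbove hbd, Real.sSup_of_not_bddAbove hEb,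
      Real.zero_rpow hspos.ne', mul_zero]
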